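/- arXiv:1312.7544 — 6 statements merged into one kernel-verified Lean document; each statement's English description precedes it below -/
import Mathlib

section
/- If v : ℝ → ℝ is a C¹ function which is 2π-periodic with zero average, then sup_{t∈ℝ} |v(t)| ≤ (π/2) · sup_{t∈ℝ} |v'(t)|. -/
open Real

theorem abs_sub_le_of_abs_deriv_le {v : ℝ → ℝ} {M : ℝ} (hv : Differentiable ℝ v)
    (hM : ∀ t, |deriv v t| ≤ M) (s t : ℝ) : |v s - v t| ≤ M * |s - t| :=
  Convex.norm_image_sub_le_of_norm_deriv_le (fun x _ => hv x) (fun x _ => hM x)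
    convex_univ (Set.mem_univ t) (Set.mem_univ s)

theorem integral_abs_neg_self {a : ℝ} (ha : 0 ≤ a) : ∫ s in (-a)..a, |s| = a ^ 2 := by
  have hint : ∀ b c : ℝ, IntervalIntegrable (fun s : ℝ => |s|) MeasureTheory.volume b c :=
    fun b c => continuous_abs.intervalIntegrable b c
  have hright : ∫ s in (0:ℝ)..a, |s| = a ^ 2 / 2 := by
    rw [intervalIntegral.integral_congr (g := fun s => s), integral_id]
    · ring
    · intro s hs
      rw [Set.uIcc_of_le ha] at hs
      exact abs_of_nonneg hs.1
  have hleft : ∫ s in (-a)..0, |s| = a ^ 2 / 2 := by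
    rw [← hright]
    simpa using intervalIntegral.integral_comp_neg (a := -a) (b := 0) (fun s : ℝ => |s|)
  rw [← intervalIntegral.integral_add_adjacent_intervals (hint _ 0) (hint 0 _), hleft, hright]
  ring

theorem abs_le_pi_div_two_mul_of_lipschitz {v : ℝ → ℝ} {M : ℝ} (hv : Continuous v)
    (hper : Function.Periodic v (2 * π)) (havg : ∫ t in (0:ℝ)..(2 * π), v t = 0)
    (hM : ∀ s t, |v s - v t| ≤ M * |s - t|) (t : ℝ) : |v t| ≤ π / 2 * M := by
  have hshift : ∫ s in (-π)..π, v (s + t) = 0 := by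
    rw [intervalIntegral.integral_comp_add_right, ← havg]
    have h := hper.intervalIntegral_add_eq (-π + t) 0
    rwa [show -π + t + 2 * π = π + t by ring, zero_add] at h
  have hdiff : ∫ s in (-π)..π, (v (s + t) - v t) = -(2 * π * v t) := by
    have hint : IntervalIntegrable (fun s => v (s + t)) MeasureTheory.volume (-π) π :=
      Continuous.intervalIntegrable (by fun_prop) _ _
    rw [intervalIntegral.integral_sub hint intervalIntegrable_const, hshift, intervalIntegral.integral_const, smul_eq_mul]
    ring
  have hbound : |∫ s in (-π)..π, (v (s + t) - v t)| ≤ ∫ s in (-π)..π, M * |s| := by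
    rw [← Real.norm_eq_abs]
    refine intervalIntegral.norm_integral_le_of_norm_le (by linarith [pi_pos])
      (Filter.Eventually.of_forall fun s _ => ?_)
      (Continuous.intervalIntegrable (by fun_prop) _ _)
    simpa using hM (s + t) t
  rw [hdiff, abs_neg, abs_mul, abs_of_pos two_pi_pos, intervalIntegral.integral_const_mul,
    integral_abs_neg_self pi_pos.le] at hbound
  refine le_of_mul_le_mul_left ?_ two_pi_pos
  linarith

theorem stmt_0 (v : ℝ → ℝ) (hv : ContDiff ℝ 1 v)
    (hper : Function.Periodic v (2 * π))
    (havg : ∫ t in (0:ℝ)..(2 * π), v t = 0) :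
    (⨆ t : ℝ, |v t|) ≤ (π / 2) * ⨆ t : ℝ, |deriv v t| := by
  have hper_deriv : Function.Periodic (fun t => |deriv v t|) (2 * π) := fun t => by
    have h := deriv_comp_add_const v (2 * π) t
    rw [funext hper] at h
    simp only [h]
  have hbdd : BddAbove (Set.range fun t => |deriv v t|) :=
    (hper_deriv.isBounded_of_continuous two_pi_pos.ne'
      (hv.continuous_deriv le_rfl).abs).bddAbove
  exact ciSup_le <| abs_le_pi_div_two_mul_of_lipschitz hv.continuous hper havg <|
    abs_sub_le_of_abs_deriv_le (hv.differentiable one_ne_zero) fun t => le_ciSup hbdd t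
end

section
/- If v : ℝ → ℝ is a C² function which is 2π-periodic with zero average, then sup_{t∈ℝ} |v(t)| ≤ (π²/8) · sup_{t∈ℝ} |v''(t)|. -/
open Real

/-- The `L¹` norm over `[-π, π]` of the quadratic Peano kernel `t ^ 2 / 2 - π ^ 2 / 8`. -/
lemma integral_abs_quadratic_kernel :
    ∫ t in (-π)..π, |t ^ 2 / 2 - π ^ 2 / 8| = π ^ 3 / 4 := by
  have hπ := pi_pos
  have hint (a b : ℝ) : IntervalIntegrable (fun t : ℝ ↦ |t ^ 2 / 2 - π ^ 2 / 8|)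
      MeasureTheory.volume a b :=
    Continuous.intervalIntegrable (by fun_prop) a b
  have hquad (a b : ℝ) : ∫ t in a..b, (t ^ 2 / 2 - π ^ 2 / 8)
      = (b ^ 3 / 6 - π ^ 2 / 8 * b) - (a ^ 3 / 6 - π ^ 2 / 8 * a) := by
    refine intervalIntegral.integral_eq_sub_of_hasDerivAt
      (f := fun t : ℝ ↦ t ^ 3 / 6 - π ^ 2 / 8 * t) (fun t _ ↦ ?_)
      (Continuous.intervalIntegrable (by fun_prop) a b)
    refine (((hasDerivAt_pow 3 t).div_const 6).sub
      ((hasDerivAt_id t).const_mul (π ^ 2 / 8))).congr_deriv ?_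
    norm_num
    ring
  have hleft : ∫ t in (-π)..(-(π / 2)), |t ^ 2 / 2 - π ^ 2 / 8|
      = ∫ t in (-π)..(-(π / 2)), (t ^ 2 / 2 - π ^ 2 / 8) := by
    refine intervalIntegral.integral_congr fun t ht ↦ abs_of_nonneg ?_
    rw [Set.uIcc_of_le (by linarith)] at ht
    nlinarith [ht.1, ht.2]
  have hmid : ∫ t in (-(π / 2))..(π / 2), |t ^ 2 / 2 - π ^ 2 / 8|
      = ∫ t in (-(π / 2))..(π / 2), -(t ^ 2 / 2 - π ^ 2 / 8) := by
    refine intervalIntegral.integral_congr fun t ht ↦ abs_of_nonpos ?_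
    rw [Set.uIcc_of_le (by linarith)] at ht
    nlinarith [ht.1, ht.2]
  have hright : ∫ t in (π / 2)..π, |t ^ 2 / 2 - π ^ 2 / 8|
      = ∫ t in (π / 2)..π, (t ^ 2 / 2 - π ^ 2 / 8) := by
    refine intervalIntegral.integral_congr fun t ht ↦ abs_of_nonneg ?_
    rw [Set.uIcc_of_le (by linarith)] at ht
    nlinarith [ht.1, ht.2]
  rw [← intervalIntegral.integral_add_adjacent_intervals (hint _ (π / 2)) (hint _ _),
    ← intervalIntegral.integral_add_adjacent_intervals (hint _ (-(π / 2))) (hint _ _),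
    hleft, hmid, hright, intervalIntegral.integral_neg, hquad, hquad, hquad]
  ring

/-- A function whose values and derivatives agree suitably at `±π` and whose integral over
`[-π, π]` vanishes is controlled at `π` by its second derivative. -/
lemma abs_apply_pi_le_of_abs_deriv_le {w w' w'' : ℝ → ℝ} {M : ℝ}
    (hw : ∀ t, HasDerivAt w (w' t) t) (hw' : ∀ t, HasDerivAt w' (w'' t) t)
    (hcont : Continuous w'') (hend : w (-π) = w π) (hend' : w' (-π) = w' π)
    (havg : ∫ t in (-π)..π, w t = 0) (hM : ∀ t, |w'' t| ≤ M) :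
    |w π| ≤ π ^ 2 / 8 * M := by
  have hπ := pi_pos
  have hwc : Continuous w := continuous_iff_continuousAt.2 fun t ↦ (hw t).continuousAt
  have hrep : ∫ t in (-π)..π, ((t ^ 2 / 2 - π ^ 2 / 8) * w'' t - w t) = -(2 * π * w π) := by
    rw [intervalIntegral.integral_eq_sub_of_hasDerivAt
      (f := fun t ↦ (t ^ 2 / 2 - π ^ 2 / 8) * w' t - t * w t) (fun t _ ↦ ?_)
      (Continuous.intervalIntegrable (by fun_prop) _ _)]
    · simp only [hend, hend']
      ring
    · refine (((((hasDerivAt_pow 2 t).div_const 2).sub_const (π ^ 2 / 8)).mul (hw' t)).sub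
        ((hasDerivAt_id t).mul (hw t))).congr_deriv ?_
      norm_num
      ring
  rw [intervalIntegral.integral_sub (Continuous.intervalIntegrable (by fun_prop) _ _)
    (hwc.intervalIntegrable _ _), havg, sub_zero] at hrep
  have hbound : ‖∫ t in (-π)..π, (t ^ 2 / 2 - π ^ 2 / 8) * w'' t‖
      ≤ ∫ t in (-π)..π, |t ^ 2 / 2 - π ^ 2 / 8| * M := by
    refine intervalIntegral.norm_integral_le_of_norm_le (by linarith)
      (Filter.Eventually.of_forall fun t _ ↦ ?_)
      (Continuous.intervalIntegrable (by fun_prop) _ _)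
    rw [norm_eq_abs, abs_mul]
    exact mul_le_mul_of_nonneg_left (hM t) (abs_nonneg _)
  rw [hrep, intervalIntegral.integral_mul_const, integral_abs_quadratic_kernel, norm_neg,
    norm_eq_abs, abs_mul, abs_of_pos (by positivity : 0 < 2 * π)] at hbound
  refine le_of_mul_le_mul_left ?_ (by positivity : 0 < 2 * π)
  linarith

theorem stmt_1 (v : ℝ → ℝ) (hv : ContDiff ℝ 2 v)
    (hper : Function.Periodic v (2 * π))
    (havg : ∫ t in (0:ℝ)..(2 * π), v t = 0) :
    (⨆ t : ℝ, |v t|) ≤ (π ^ 2 / 8) * ⨆ t : ℝ, |deriv (deriv v) t| := by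
  have hper_deriv {f : ℝ → ℝ} (hf : Function.Periodic f (2 * π)) :
      Function.Periodic (deriv f) (2 * π) := fun t ↦ by
    rw [← deriv_comp_add_const, funext hf]
  have hv' : ContDiff ℝ 1 (deriv v) := ContDiff.deriv' hv
  have hcont : Continuous (deriv (deriv v)) := hv'.continuous_deriv le_rfl
  have hbdd : BddAbove (Set.range fun t ↦ |deriv (deriv v) t|) := by
    have hp : Function.Periodic (fun t ↦ |deriv (deriv v) t|) (2 * π) :=
      (hper_deriv (hper_deriv hper)).comp abs
    exact (hp.compact_of_continuous (by positivity) hcont.abs).bddAbove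
  refine ciSup_le fun x ↦ ?_
  have hend {f : ℝ → ℝ} (hf : Function.Periodic f (2 * π)) :
      f (-π + (x - π)) = f (π + (x - π)) := by
    rw [← hf (-π + (x - π))]
    congr 1
    ring
  have key := abs_apply_pi_le_of_abs_deriv_le (w := fun t ↦ v (t + (x - π)))
    (w' := fun t ↦ deriv v (t + (x - π))) (w'' := fun t ↦ deriv (deriv v) (t + (x - π)))
    (fun t ↦ ((hv.differentiable (by norm_num)) _).hasDerivAt.comp_add_const t (x - π))
    (fun t ↦ ((hv'.differentiable (by norm_num)) _).hasDerivAt.comp_add_const t (x - π))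
    (by fun_prop) (hend hper) (hend (hper_deriv hper))
    (by
      rw [intervalIntegral.integral_comp_add_right (fun t ↦ v t), ← havg]
      convert hper.intervalIntegral_add_eq (-π + (x - π)) 0 using 2 <;> ring)
    (fun t ↦ le_ciSup hbdd (t + (x - π)))
  simpa using key
end

section
/- Let 0 ≤ η̂ < 2/π and let u : ℝ → ℝ be a C² function which is 2π-periodic with zero average. Set g(t) := u''(t) + η̂·u'(t). Then ‖u'‖ ≤ (π/2)·(1 − (π/2)·η̂)⁻¹ · ‖g‖. -/
open Real

/-- A symmetric difference is approximated by the derivative at the midpoint, with quadratic error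
controlled by a bound on the second derivative. -/
theorem abs_symmetric_difference_sub_le {u : ℝ → ℝ} {M : ℝ} (hu : Differentiable ℝ u)
    (hu' : Differentiable ℝ (deriv u)) (hM : ∀ t, |deriv (deriv u) t| ≤ M) (t : ℝ) {s : ℝ}
    (hs : 0 ≤ s) : |u (t + s) - u (t - s) - 2 * s * deriv u t| ≤ M * s ^ 2 := by
  have hlip (x y : ℝ) : |deriv u y - deriv u x| ≤ M * |y - x| :=
    Convex.norm_image_sub_le_of_norm_deriv_le (fun z _ => hu' z) (fun z _ => hM z)
      convex_univ (Set.mem_univ x) (Set.mem_univ y)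
  have hderiv (x : ℝ) : HasDerivAt (fun s => u (t + s) - u (t - s) - 2 * s * deriv u t)
      (deriv u (t + x) + deriv u (t - x) - 2 * deriv u t) x := by
    have h₁ := (hu (t + x)).hasDerivAt.comp x ((hasDerivAt_id x).const_add t)
    have h₂ := (hu (t - x)).hasDerivAt.comp x ((hasDerivAt_id x).const_sub t)
    have h₃ := ((hasDerivAt_id x).const_mul 2).mul_const (deriv u t)
    exact ((h₁.sub h₂).sub h₃).congr_deriv (by ring)
  refine image_norm_le_of_norm_deriv_right_le_deriv_boundary
    (B := fun x => M * x ^ 2) (B' := fun x => 2 * M * x)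
    (fun x _ => (hderiv x).continuousAt.continuousWithinAt)
    (fun x _ => (hderiv x).hasDerivWithinAt) (by simp) (fun x => ?_) (fun x hx => ?_)
    (Set.right_mem_Icc.mpr hs)
  · exact ((hasDerivAt_pow 2 x).const_mul M).congr_deriv (by push_cast; ring)
  · have h₁ := hlip t (t + x)
    have h₂ := hlip t (t - x)
    rw [add_sub_cancel_left, abs_of_nonneg hx.1] at h₁
    rw [sub_sub_cancel_left, abs_neg, abs_of_nonneg hx.1] at h₂
    rw [Real.norm_eq_abs]
    rw [abs_le] at h₁ h₂ ⊢
    constructor <;> linarith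

/-- The derivative of a `2π`-periodic function is bounded by `π / 2` times a bound on its second
derivative. -/
theorem abs_deriv_le_of_periodic {u : ℝ → ℝ} {M : ℝ} (hu : Differentiable ℝ u)
    (hu' : Differentiable ℝ (deriv u)) (hper : Function.Periodic u (2 * π))
    (hM : ∀ t, |deriv (deriv u) t| ≤ M) (t : ℝ) : |deriv u t| ≤ π / 2 * M := by
  have h := abs_symmetric_difference_sub_le hu hu' hM t pi_pos.le
  have hp : u (t + π) = u (t - π) := by
    rw [← hper (t - π)]
    ring_nf
  rw [hp, sub_self, zero_sub, abs_neg, abs_mul, abs_of_pos two_pi_pos] at h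
  refine le_of_mul_le_mul_left ?_ two_pi_pos
  linarith

theorem Function.Periodic.bddAbove_range_abs {f : ℝ → ℝ} {c : ℝ} (hf : Function.Periodic f c)
    (hc : c ≠ 0) (hcont : Continuous f) : BddAbove (Set.range fun t => |f t|) := by
  have hper : Function.Periodic (fun t => |f t|) c := fun t => by simp only [hf t]
  exact (hper.compact_of_continuous hc hcont.abs).bddAbove

theorem Function.Periodic.deriv_periodic {f : ℝ → ℝ} {c : ℝ} (hf : Function.Periodic f c) :
    Function.Periodic (deriv f) c := fun t => by
  rw [← deriv_comp_add_const, funext hf]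

theorem stmt_2 (η : ℝ) (hη0 : 0 ≤ η) (hη : η < 2 / π)
    (u : ℝ → ℝ) (hu : ContDiff ℝ 2 u)
    (hper : Function.Periodic u (2 * π))
    (havg : ∫ t in (0:ℝ)..(2 * π), u t = 0)
    (g : ℝ → ℝ) (hg : ∀ t, g t = deriv (deriv u) t + η * deriv u t) :
    (⨆ t : ℝ, |deriv u t|) ≤ (π / 2) * (1 - (π / 2) * η)⁻¹ * ⨆ t : ℝ, |g t| := by
  have hv : ContDiff ℝ 1 (deriv u) := ContDiff.deriv' (n := 1) (by rwa [one_add_one_eq_two])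
  have hvper := hper.deriv_periodic
  have hgper : Function.Periodic g (2 * π) := fun t => by
    rw [hg, hg, hvper t, hvper.deriv_periodic t]
  have hgcont : Continuous g := by
    rw [funext hg]
    exact (hv.continuous_deriv le_rfl).add (continuous_const.mul hv.continuous)
  have hvbdd := hvper.bddAbove_range_abs two_pi_pos.ne' hv.continuous
  have hgbdd := hgper.bddAbove_range_abs two_pi_pos.ne' hgcont
  set V := ⨆ t : ℝ, |deriv u t|
  set G := ⨆ t : ℝ, |g t|
  have hM (t : ℝ) : |deriv (deriv u) t| ≤ G + η * V := by
    have h₁ : |g t| ≤ G := le_ciSup hgbdd t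
    have h₂ : |deriv u t| ≤ V := le_ciSup hvbdd t
    calc |deriv (deriv u) t| = |g t - η * deriv u t| := by rw [hg t, add_sub_cancel_right]
      _ ≤ |g t| + |η * deriv u t| := abs_sub _ _
      _ = |g t| + η * |deriv u t| := by rw [abs_mul, abs_of_nonneg hη0]
      _ ≤ G + η * V := by gcongr
  have hV : V ≤ π / 2 * (G + η * V) := ciSup_le <|
    abs_deriv_le_of_periodic (hu.differentiable two_ne_zero) (hv.differentiable one_ne_zero) hper hM
  have hpos : 0 < 1 - π / 2 * η := by
    rw [lt_div_iff₀ pi_pos] at hη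
    linarith
  rw [mul_right_comm, ← div_eq_mul_inv, le_div_iff₀ hpos]
  linarith
end

section
/- Let η̂ ≥ 0 and let g : ℝ → ℝ be continuous, 2π-periodic with zero average. Then there exists a unique C² function u : ℝ → ℝ, 2π-periodic with zero average, such that u''(t) + η̂·u'(t) = g(t) for all t ∈ ℝ. -/
open Real

/-- Solutions of `w' = -η w` are multiples of `exp (-η t)`. -/
lemma eq_exp_mul_of_hasDerivAt {η : ℝ} {w : ℝ → ℝ}
    (hw : ∀ t, HasDerivAt w (-η * w t) t) (s t : ℝ) :
    w t = exp (η * (s - t)) * w s := by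
  have hd : ∀ x, HasDerivAt (fun x => exp (η * x) * w x) 0 x := by
    intro x
    have h1 : HasDerivAt (fun x : ℝ => exp (η * x)) (exp (η * x) * (η * 1)) x :=
      ((hasDerivAt_id x).const_mul η).exp
    exact (h1.mul (hw x)).congr_deriv (by ring)
  have h : exp (η * t) * w t = exp (η * s) * w s :=
    is_const_of_deriv_eq_zero (fun x => (hd x).differentiableAt) (fun x => (hd x).deriv) t s
  rw [mul_sub, exp_sub, div_mul_eq_mul_div, ← h, mul_div_cancel_left₀ _ (exp_pos _).ne']

/-- A function whose derivative is `T`-periodic of zero average is `T`-periodic. -/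
lemma periodic_of_hasDerivAt {T : ℝ} {F f : ℝ → ℝ} (hF : ∀ t, HasDerivAt F (f t) t)
    (hf : Continuous f) (hper : Function.Periodic f T) (havg : ∫ t in (0 : ℝ)..T, f t = 0) :
    Function.Periodic F T := by
  intro t
  have h := intervalIntegral.integral_eq_sub_of_hasDerivAt (a := t) (b := t + T)
    (fun x _ => hF x) (hf.intervalIntegrable _ _)
  rw [hper.intervalIntegral_add_eq t 0, zero_add, havg] at h
  linarith

/-- A continuous periodic function of zero average has a periodic primitive of zero average. -/
lemma exists_periodic_primitive {T : ℝ} (hT : 0 < T) {f : ℝ → ℝ} (hf : Continuous f)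
    (hper : Function.Periodic f T) (havg : ∫ t in (0 : ℝ)..T, f t = 0) :
    ∃ F : ℝ → ℝ, Function.Periodic F T ∧ (∫ t in (0 : ℝ)..T, F t = 0) ∧
      ∀ t, HasDerivAt F (f t) t := by
  set P : ℝ → ℝ := fun t => ∫ s in (0 : ℝ)..t, f s
  have hP : ∀ t, HasDerivAt P (f t) t := fun t => hf.integral_hasStrictDerivAt 0 t |>.hasDerivAt
  have hPc : Continuous P := continuous_iff_continuousAt.2 fun t => (hP t).continuousAt
  have hF : ∀ t, HasDerivAt (fun t => P t - (∫ s in (0 : ℝ)..T, P s) / T) (f t) t :=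
    fun t => (hP t).sub_const _
  refine ⟨_, periodic_of_hasDerivAt hF hf hper havg, ?_, hF⟩
  rw [intervalIntegral.integral_sub (hPc.intervalIntegrable _ _) (by simp),
    intervalIntegral.integral_const, smul_eq_mul, sub_zero, mul_div_cancel₀ _ hT.ne', sub_self]

/-- The equation `v' + η v = f` has a periodic solution of zero average. -/
lemma exists_periodic_solution_first_order {T : ℝ} (hT : 0 < T) {η : ℝ} (hη : 0 ≤ η) {f : ℝ → ℝ}
    (hf : Continuous f) (hper : Function.Periodic f T) (havg : ∫ t in (0 : ℝ)..T, f t = 0) :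
    ∃ v : ℝ → ℝ, Function.Periodic v T ∧ (∫ t in (0 : ℝ)..T, v t = 0) ∧
      ∀ t, HasDerivAt v (f t - η * v t) t := by
  rcases hη.eq_or_lt with rfl | hη
  · simpa using exists_periodic_primitive hT hf hper havg
  set P : ℝ → ℝ := fun t => ∫ s in (0 : ℝ)..t, exp (η * s) * f s with hPdef
  have hP : ∀ t, HasDerivAt P (exp (η * t) * f t) t := fun t =>
    (Continuous.integral_hasStrictDerivAt (f := fun s => exp (η * s) * f s)
      (by fun_prop) 0 t).hasDerivAt
  have hE : exp (-η * T) < 1 := exp_lt_one_iff.2 (by nlinarith)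
  obtain ⟨c, hc⟩ : ∃ c, exp (-η * T) * (c + P T) = c := by
    refine ⟨exp (-η * T) * P T / (1 - exp (-η * T)), ?_⟩
    generalize exp (-η * T) = E at hE
    have : 1 - E ≠ 0 := by linarith
    field_simp
    ring
  set v : ℝ → ℝ := fun t => exp (-η * t) * (c + P t) with hvdef
  have hv : ∀ t, HasDerivAt v (f t - η * v t) t := by
    intro t
    have h1 : HasDerivAt (fun x : ℝ => exp (-η * x)) (exp (-η * t) * (-η * 1)) t :=
      ((hasDerivAt_id t).const_mul (-η)).exp
    have h2 : exp (-η * t) * exp (η * t) = 1 := by rw [← exp_add]; simp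
    refine (h1.mul ((hP t).const_add c)).congr_deriv ?_
    simp only [hvdef]
    linear_combination f t * h2
  have hvT : v T = v 0 := by simp [hvdef, hPdef] at hc ⊢; exact hc
  have hvc : Continuous v := continuous_iff_continuousAt.2 fun t => (hv t).continuousAt
  refine ⟨v, fun t => ?_, ?_, hv⟩
  · have hw : ∀ t, HasDerivAt (fun t => v (t + T) - v t) (-η * (v (t + T) - v t)) t := by
      intro t
      refine (((hv (t + T)).comp_add_const t T).sub (hv t)).congr_deriv ?_
      rw [hper t]
      ring
    have h := eq_exp_mul_of_hasDerivAt hw 0 t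
    simp only [zero_add, hvT, sub_self, mul_zero] at h
    linarith
  · have h := intervalIntegral.integral_eq_sub_of_hasDerivAt (a := 0) (b := T)
      (fun x _ => hv x) ((hf.sub (hvc.const_mul η)).intervalIntegrable _ _)
    rw [intervalIntegral.integral_sub (hf.intervalIntegrable _ _)
      ((hvc.const_mul η).intervalIntegrable _ _), intervalIntegral.integral_const_mul, havg,
      hvT, sub_self, zero_sub, neg_eq_zero] at h
    exact (mul_eq_zero.1 h).resolve_left hη.ne'

/-- A periodic solution of zero average of `d'' + η d' = 0` vanishes. -/
lemma eq_zero_of_periodic_of_homogeneous {T : ℝ} (hT : 0 < T) {η : ℝ} {d d' : ℝ → ℝ}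
    (hd : ∀ t, HasDerivAt d (d' t) t) (hd' : ∀ t, HasDerivAt d' (-η * d' t) t)
    (hper : Function.Periodic d T) (havg : ∫ t in (0 : ℝ)..T, d t = 0) (t : ℝ) : d t = 0 := by
  obtain ⟨ξ, -, hξ⟩ := exists_hasDerivAt_eq_zero hT
    (fun x _ => (hd x).continuousAt.continuousWithinAt) (by simpa using (hper 0).symm)
    (fun x _ => hd x)
  have hz : ∀ x, d' x = 0 := fun x => by rw [eq_exp_mul_of_hasDerivAt hd' ξ x, hξ, mul_zero]
  have hconst : ∀ x, d x = d t := fun x =>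
    is_const_of_deriv_eq_zero (fun x => (hd x).differentiableAt)
      (fun x => by rw [(hd x).deriv, hz]) x t
  simp only [hconst, intervalIntegral.integral_const, sub_zero, smul_eq_mul] at havg
  exact (mul_eq_zero.1 havg).resolve_left hT.ne'

theorem stmt_5 (η : ℝ) (hη : 0 ≤ η)
    (g : ℝ → ℝ) (hg : Continuous g)
    (hper : Function.Periodic g (2 * π))
    (havg : ∫ t in (0:ℝ)..(2 * π), g t = 0) :
    ∃! u : ℝ → ℝ, ContDiff ℝ 2 u ∧ Function.Periodic u (2 * π) ∧
      (∫ t in (0:ℝ)..(2 * π), u t = 0) ∧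
      ∀ t, deriv (deriv u) t + η * deriv u t = g t := by
  obtain ⟨v, hvper, hvavg, hv⟩ :=
    exists_periodic_solution_first_order two_pi_pos hη hg hper havg
  have hvc : Continuous v := continuous_iff_continuousAt.2 fun t => (hv t).continuousAt
  obtain ⟨u, huper, huavg, hu⟩ := exists_periodic_primitive two_pi_pos hvc hvper hvavg
  have hdu : deriv u = v := funext fun t => (hu t).deriv
  have hdv : deriv v = fun t => g t - η * v t := funext fun t => (hv t).deriv
  have hv1 : ContDiff ℝ 1 v := contDiff_one_iff_deriv.2
    ⟨fun t => (hv t).differentiableAt, by rw [hdv]; fun_prop⟩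
  have hu2 : ContDiff ℝ 2 u := by
    rw [show (2 : WithTop ℕ∞) = 1 + 1 by norm_num, contDiff_succ_iff_deriv]
    exact ⟨fun t => (hu t).differentiableAt, by simp, by rwa [hdu]⟩
  refine ⟨u, ⟨hu2, huper, huavg, fun t => by simp [hdu, hdv]⟩, ?_⟩
  rintro w ⟨hw2, hwper, hwavg, hw⟩
  have hw1 : ContDiff ℝ 1 (deriv w) := by
    rw [show (2 : WithTop ℕ∞) = 1 + 1 by norm_num, contDiff_succ_iff_deriv] at hw2
    exact hw2.2.2
  have hwd : ∀ t, HasDerivAt w (deriv w t) t := fun t =>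
    (hw2.differentiable (by norm_num) t).hasDerivAt
  have hwdd : ∀ t, HasDerivAt (deriv w) (g t - η * deriv w t) t := fun t =>
    ((hw1.differentiable (by norm_num) t).hasDerivAt).congr_deriv (by linarith [hw t])
  funext t
  refine sub_eq_zero.1 (eq_zero_of_periodic_of_homogeneous (d := fun t => w t - u t)
    (d' := fun t => deriv w t - v t) (η := η) two_pi_pos
    (fun t => (hwd t).sub (hu t)) (fun t => ((hwdd t).sub (hv t)).congr_deriv (by ring))
    (hwper.sub huper) ?_ t)
  rw [intervalIntegral.integral_sub (hw2.continuous.intervalIntegrable _ _)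
    (hu2.continuous.intervalIntegrable _ _), hwavg, huavg, sub_self]
end

section
/- Let e ∈ [0,1), let p, q be nonzero integers, let ξ ∈ ℝ, let η̂ ≥ 0 with η̂ ≤ (π/5)·(10/π² − 1), and let ε̂ ≥ 0 satisfy 5·ε̂/(1−e)³ < 1. Set R := (5/2)·ε̂/(1−e)³. Then there exists a unique continuous function u : ℝ → ℝ, 2π-periodic with zero average and with sup_{t∈ℝ}|u(t)| ≤ R, such that u is C² and u''(t) + η̂·u'(t) = ε̂·( −f_x(ξ + p·t + u(t), q·t) + (1/2π)·∫₀^{2π} f_x(ξ + p·s + u(s), q·s) ds ) for all t ∈ ℝ. -/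
open Real

/-- The mean over one period of `k` times the translate of `w` by `t`. -/
noncomputable def shiftMean (k w : ℝ → ℝ) (t : ℝ) : ℝ :=
  (1 / (2 * π)) * ∫ x in (0:ℝ)..(2 * π), k x * w (t + x)

/-- The zero-average periodic Green kernel of the second derivative on `[0, 2π]`. -/
noncomputable def greenKernel (x : ℝ) : ℝ := π ^ 2 / 6 - (x - π) ^ 2 / 2

/-- The zero-average periodic Green kernel of the first derivative on `[0, 2π]`. -/
noncomputable def sawtoothKernel (x : ℝ) : ℝ := x - π

lemma continuous_greenKernel : Continuous greenKernel := by
  unfold greenKernel; fun_prop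

lemma continuous_sawtoothKernel : Continuous sawtoothKernel := by
  unfold sawtoothKernel; fun_prop

lemma continuous_shiftMean {k w : ℝ → ℝ} (hk : Continuous k) (hw : Continuous w) :
    Continuous (shiftMean k w) := by
  unfold shiftMean
  refine continuous_const.mul
    (intervalIntegral.continuous_parametric_intervalIntegral_of_continuous' ?_ _ _)
  simp only [Function.uncurry_def]
  fun_prop

lemma shiftMean_sub {k v w : ℝ → ℝ} (hk : Continuous k) (hv : Continuous v)
    (hw : Continuous w) (t : ℝ) :
    shiftMean k v t - shiftMean k w t = shiftMean k (fun x => v x - w x) t := by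
  unfold shiftMean
  rw [← mul_sub, ← intervalIntegral.integral_sub
    (Continuous.intervalIntegrable (by fun_prop) _ _)
    (Continuous.intervalIntegrable (by fun_prop) _ _)]
  simp only [mul_sub]

lemma shiftMean_const (k : ℝ → ℝ) (c t : ℝ) :
    shiftMean k (fun _ => c) t = (1 / (2 * π)) * (∫ x in (0:ℝ)..(2 * π), k x) * c := by
  simp only [shiftMean, intervalIntegral.integral_mul_const, mul_assoc]

lemma shiftMean_comp_add (k w : ℝ → ℝ) (a t : ℝ) :
    shiftMean k (fun x => w (x + a)) t = shiftMean k w (t + a) := by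
  simp only [shiftMean, add_right_comm]

lemma abs_shiftMean_le {k m w : ℝ → ℝ} (hm : Continuous m)
    (hkm : ∀ x ∈ Set.Icc 0 (2 * π), |k x| ≤ m x) {C : ℝ} (hwC : ∀ x, |w x| ≤ C) (t : ℝ) :
    |shiftMean k w t| ≤ (1 / (2 * π)) * (∫ x in (0:ℝ)..(2 * π), m x) * C := by
  have hC : 0 ≤ C := (abs_nonneg _).trans (hwC 0)
  have h := intervalIntegral.norm_integral_le_of_norm_le (μ := MeasureTheory.volume)
    (f := fun x => k x * w (t + x)) (g := fun x => m x * C) two_pi_pos.le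
    (Filter.Eventually.of_forall fun x hx => by
      have hk := hkm x (Set.Ioc_subset_Icc_self hx)
      rw [norm_mul]
      exact mul_le_mul hk (hwC _) (norm_nonneg _) ((abs_nonneg _).trans hk))
    (Continuous.intervalIntegrable (by fun_prop) _ _)
  rw [intervalIntegral.integral_mul_const, norm_eq_abs] at h
  have hpi : 0 < 1 / (2 * π) := by positivity
  rw [shiftMean, abs_mul, abs_of_pos hpi, mul_assoc]
  exact mul_le_mul_of_nonneg_left h hpi.le

lemma integral_greenKernel : ∫ x in (0:ℝ)..(2 * π), greenKernel x = 0 := by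
  have h : ∀ x ∈ Set.uIcc 0 (2 * π),
      HasDerivAt (fun x => π ^ 2 / 6 * x - (x - π) ^ 3 / 6) (greenKernel x) x := by
    intro x _
    have h1 := ((hasDerivAt_id x).const_mul (π ^ 2 / 6)).sub
      ((((hasDerivAt_id x).sub_const π).pow 3).div_const 6)
    refine h1.congr_deriv ?_
    simp [greenKernel]; ring
  rw [intervalIntegral.integral_eq_sub_of_hasDerivAt h
    (continuous_greenKernel.intervalIntegrable _ _)]
  ring

lemma integral_sawtoothKernel : ∫ x in (0:ℝ)..(2 * π), sawtoothKernel x = 0 := by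
  simp [sawtoothKernel]; ring

lemma integral_greenKernel_sq :
    ∫ x in (0:ℝ)..(2 * π), greenKernel x ^ 2 = 2 * π * (π ^ 4 / 45) := by
  have h : ∀ x ∈ Set.uIcc 0 (2 * π),
      HasDerivAt (fun x => π ^ 4 / 36 * x - π ^ 2 * (x - π) ^ 3 / 18 + (x - π) ^ 5 / 20)
        (greenKernel x ^ 2) x := by
    intro x _
    have h1 := (((hasDerivAt_id x).const_mul (π ^ 4 / 36)).sub
      (((((hasDerivAt_id x).sub_const π).pow 3).const_mul (π ^ 2)).div_const 18)).add
      ((((hasDerivAt_id x).sub_const π).pow 5).div_const 20)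
    refine h1.congr_deriv ?_
    simp [greenKernel]; ring
  rw [intervalIntegral.integral_eq_sub_of_hasDerivAt h
    ((continuous_greenKernel.pow 2).intervalIntegrable _ _)]
  ring

lemma abs_shiftMean_greenKernel_le {w : ℝ → ℝ} {C : ℝ} (hwC : ∀ x, |w x| ≤ C) (t : ℝ) :
    |shiftMean greenKernel w t| ≤ 3 / 2 * C := by
  have hC : 0 ≤ C := (abs_nonneg _).trans (hwC 0)
  have hc := continuous_greenKernel
  have h := abs_shiftMean_le (k := greenKernel)
    (m := fun x => greenKernel x ^ 2 * (1 / 3) + 3 / 4) (by fun_prop)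
    (fun x _ => by
      rw [← sq_abs (greenKernel x)]
      nlinarith [sq_nonneg (|greenKernel x| - 3 / 2)]) hwC t
  rw [intervalIntegral.integral_add (Continuous.intervalIntegrable (by fun_prop) _ _)
    (Continuous.intervalIntegrable (by fun_prop) _ _), intervalIntegral.integral_mul_const,
    integral_greenKernel_sq, intervalIntegral.integral_const] at h
  refine h.trans (mul_le_mul_of_nonneg_right ?_ hC)
  have h4 : π ^ 4 ≤ 3.15 ^ 4 := pow_le_pow_left₀ pi_pos.le pi_lt_d2.le 4
  have hpi := pi_ne_zero
  have : 1 / (2 * π) * (2 * π * (π ^ 4 / 45) * (1 / 3) + (2 * π - 0) • (3 / 4 : ℝ)) =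
      π ^ 4 / 135 + 3 / 4 := by
    rw [smul_eq_mul]; field_simp; ring
  rw [this]
  norm_num at h4
  linarith

lemma abs_shiftMean_sawtoothKernel_le {w : ℝ → ℝ} {C : ℝ} (hwC : ∀ x, |w x| ≤ C) (t : ℝ) :
    |shiftMean sawtoothKernel w t| ≤ π * C := by
  have h := abs_shiftMean_le (k := sawtoothKernel) (m := fun _ => π) continuous_const
    (fun x hx => by
      rw [sawtoothKernel, abs_le]
      constructor <;> linarith [hx.1, hx.2]) hwC t
  rw [intervalIntegral.integral_const, smul_eq_mul] at h
  refine h.trans_eq ?_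
  have hpi := pi_ne_zero
  field_simp
  ring

/-- Integration by parts against the sawtooth kernel recovers a periodic function from its derivative. -/
lemma integral_sawtoothKernel_mul_deriv {v v' : ℝ → ℝ} (hv : ∀ t, HasDerivAt v (v' t) t)
    (hv' : Continuous v') (hper : Function.Periodic v (2 * π)) (t : ℝ) :
    ∫ x in (0:ℝ)..(2 * π), sawtoothKernel x * v' (t + x) =
      2 * π * v t - ∫ x in (0:ℝ)..(2 * π), v x := by
  have h := intervalIntegral.integral_mul_deriv_eq_deriv_mul (a := 0) (b := 2 * π)
    (u := sawtoothKernel) (u' := fun _ => 1) (v := fun x => v (t + x))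
    (v' := fun x => v' (t + x))
    (fun x _ => (hasDerivAt_id x).sub_const π)
    (fun x _ => (hv (t + x)).comp_const_add t x)
    (continuous_const.intervalIntegrable _ _)
    (Continuous.intervalIntegrable (by fun_prop) _ _)
  have hi : ∫ x in (0:ℝ)..(2 * π), v (t + x) = ∫ x in (0:ℝ)..(2 * π), v x := by
    rw [intervalIntegral.integral_comp_add_left (fun x => v x), add_zero,
      hper.intervalIntegral_add_eq t 0, zero_add]
  simp only [one_mul, hi, hper t, add_zero, sawtoothKernel] at h
  simp only [sawtoothKernel]
  rw [h]
  ring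

lemma shiftMean_sawtoothKernel_deriv {v v' : ℝ → ℝ} (hv : ∀ t, HasDerivAt v (v' t) t)
    (hv' : Continuous v') (hper : Function.Periodic v (2 * π))
    (hav : ∫ x in (0:ℝ)..(2 * π), v x = 0) (t : ℝ) :
    shiftMean sawtoothKernel v' t = v t := by
  rw [shiftMean, integral_sawtoothKernel_mul_deriv hv hv' hper, hav]
  have hpi := pi_ne_zero
  field_simp
  ring

lemma integral_deriv_eq_zero_of_periodic {v v' : ℝ → ℝ} (hv : ∀ t, HasDerivAt v (v' t) t)
    (hv' : Continuous v') (hper : Function.Periodic v (2 * π)) :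
    ∫ x in (0:ℝ)..(2 * π), v' x = 0 := by
  rw [intervalIntegral.integral_eq_sub_of_hasDerivAt (fun x _ => hv x)
    (hv'.intervalIntegrable _ _), sub_eq_zero]
  simpa using hper 0

lemma periodic_of_hasDerivAt_s12 {v v' : ℝ → ℝ} {c : ℝ} (hv : ∀ t, HasDerivAt v (v' t) t)
    (hper : Function.Periodic v c) : Function.Periodic v' c := fun t => by
  have h1 := (hv (t + c)).comp_add_const t c
  have h2 : (fun x => v (x + c)) = v := funext hper
  rw [h2] at h1
  exact h1.unique (hv t)

lemma shiftMean_greenKernel_deriv_deriv {v v' v'' : ℝ → ℝ}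
    (hv : ∀ t, HasDerivAt v (v' t) t) (hv' : ∀ t, HasDerivAt v' (v'' t) t)
    (hv'' : Continuous v'') (hper : Function.Periodic v (2 * π))
    (hav : ∫ x in (0:ℝ)..(2 * π), v x = 0) (t : ℝ) :
    shiftMean greenKernel v'' t = v t := by
  have hc : Continuous v' := continuous_iff_continuousAt.2 fun t => (hv' t).continuousAt
  have h := intervalIntegral.integral_mul_deriv_eq_deriv_mul (a := 0) (b := 2 * π)
    (u := greenKernel) (u' := fun x => -sawtoothKernel x) (v := fun x => v' (t + x))
    (v' := fun x => v'' (t + x))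
    (fun x _ => by
      have h1 := ((((hasDerivAt_id x).sub_const π).pow 2).div_const 2).const_sub (π ^ 2 / 6)
      refine h1.congr_deriv ?_
      simp [sawtoothKernel])
    (fun x _ => (hv' (t + x)).comp_const_add t x)
    (continuous_sawtoothKernel.neg.intervalIntegrable _ _)
    (Continuous.intervalIntegrable (by fun_prop) _ _)
  rw [← shiftMean_sawtoothKernel_deriv hv hc hper hav t]
  simp only [shiftMean]
  rw [h, periodic_of_hasDerivAt_s12 hv hper t]
  simp only [greenKernel, neg_mul, intervalIntegral.integral_neg]
  ring_nf

/-- A zero-average continuous periodic function has a zero-average periodic primitive. -/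
lemma exists_periodic_primitive_s12 {w : ℝ → ℝ} (hw : Continuous w)
    (hper : Function.Periodic w (2 * π)) (hav : ∫ x in (0:ℝ)..(2 * π), w x = 0) :
    ∃ v : ℝ → ℝ, (∀ t, HasDerivAt v (w t) t) ∧ Function.Periodic v (2 * π) ∧
      ∫ x in (0:ℝ)..(2 * π), v x = 0 := by
  have hd : ∀ t, HasDerivAt (fun s => ∫ x in (0:ℝ)..s, w x) (w t) t := fun t =>
    (hw.integral_hasStrictDerivAt 0 t).hasDerivAt
  have hc : Continuous (fun s => ∫ x in (0:ℝ)..s, w x) :=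
    continuous_iff_continuousAt.2 fun t => (hd t).continuousAt
  refine ⟨fun s => (∫ x in (0:ℝ)..s, w x) -
    (1 / (2 * π)) * ∫ r in (0:ℝ)..(2 * π), ∫ x in (0:ℝ)..r, w x,
    fun t => (hd t).sub_const _, fun t => ?_, ?_⟩
  · have h := intervalIntegral.integral_add_adjacent_intervals
      (hw.intervalIntegrable (μ := MeasureTheory.volume) 0 t)
      (hw.intervalIntegrable t (t + 2 * π))
    rw [hper.intervalIntegral_add_eq t 0, zero_add, hav, add_zero] at h
    simp only [h]
  · rw [intervalIntegral.integral_sub (hc.intervalIntegrable _ _)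
      (continuous_const.intervalIntegrable _ _), intervalIntegral.integral_const, smul_eq_mul]
    have hpi := pi_ne_zero
    field_simp
    ring

lemma shiftMean_sub_const {k w : ℝ → ℝ} (hk : Continuous k) (hw : Continuous w)
    (hk0 : ∫ x in (0:ℝ)..(2 * π), k x = 0) (c t : ℝ) :
    shiftMean k (fun x => w x - c) t = shiftMean k w t := by
  rw [← shiftMean_sub hk hw continuous_const, shiftMean_const, hk0]
  ring

/-- The integral form of the damped forced equation has a unique bounded continuous solution,
which is moreover periodic. -/
lemma exists_unique_bounded_fixedPoint {F : ℝ → ℝ → ℝ} (hF : Continuous fun z : ℝ × ℝ => F z.1 z.2)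
    (hFper : ∀ t y, F (t + 2 * π) y = F t y) {A : ℝ} (hFA : ∀ t y, |F t y| ≤ A)
    (hFL : ∀ t y z, |F t y - F t z| ≤ 2 * A * |y - z|) (hA : 5 * A < 1)
    {η : ℝ} (hη0 : 0 ≤ η) (hη : η ≤ 1 / 100) :
    ∃ w : ℝ → ℝ, Continuous w ∧ Function.Periodic w (2 * π) ∧ (∀ t, |w t| ≤ 3 / 2 * A) ∧
      (∀ t, w t = F t (shiftMean greenKernel w t) - η * shiftMean sawtoothKernel w t) ∧
      ∀ v : ℝ → ℝ, Continuous v → (∃ C, ∀ t, |v t| ≤ C) →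
        (∀ t, v t = F t (shiftMean greenKernel v t) - η * shiftMean sawtoothKernel v t) →
        v = w := by
  have hA0 : 0 ≤ A := (abs_nonneg _).trans (hFA 0 0)
  have hηπ : η * π ≤ 1 / 25 := by nlinarith [pi_lt_d2, pi_pos]
  have hdamp : ∀ {w : ℝ → ℝ} {C : ℝ}, (∀ t, |w t| ≤ C) → ∀ t,
      |η * shiftMean sawtoothKernel w t| ≤ 1 / 25 * C := by
    intro w C hC t
    have hC0 : 0 ≤ C := (abs_nonneg _).trans (hC 0)
    rw [abs_mul, abs_of_nonneg hη0]
    calc η * |shiftMean sawtoothKernel w t| ≤ η * (π * C) :=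
          mul_le_mul_of_nonneg_left (abs_shiftMean_sawtoothKernel_le hC t) hη0
      _ = η * π * C := by ring
      _ ≤ 1 / 25 * C := mul_le_mul_of_nonneg_right hηπ hC0
  have hcont : ∀ {w : ℝ → ℝ}, Continuous w → Continuous fun t =>
      F t (shiftMean greenKernel w t) - η * shiftMean sawtoothKernel w t := fun hw =>
    (hF.comp (continuous_id.prodMk (continuous_shiftMean continuous_greenKernel hw))).sub
      (continuous_const.mul (continuous_shiftMean continuous_sawtoothKernel hw))
  have hbound : ∀ {w : ℝ → ℝ} {C : ℝ}, (∀ t, |w t| ≤ C) → ∀ t,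
      |F t (shiftMean greenKernel w t) - η * shiftMean sawtoothKernel w t| ≤ A + 1 / 25 * C :=
    fun hC t => (abs_sub _ _).trans (add_le_add (hFA _ _) (hdamp hC t))
  let T : BoundedContinuousFunction ℝ ℝ → BoundedContinuousFunction ℝ ℝ := fun w =>
    BoundedContinuousFunction.ofNormedAddCommGroup
      (fun t => F t (shiftMean greenKernel w t) - η * shiftMean sawtoothKernel w t)
      (hcont w.continuous) (A + 1 / 25 * ‖w‖) (hbound fun t => w.norm_coe_le_norm t)
  have hT : ContractingWith (4 / 5) T := by
    refine ⟨by rw [← NNReal.coe_lt_coe]; norm_num, LipschitzWith.of_dist_le_mul fun v w => ?_⟩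
    have hd : ∀ t, |v t - w t| ≤ dist v w := fun t =>
      BoundedContinuousFunction.dist_coe_le_dist (f := v) (g := w) t
    refine (BoundedContinuousFunction.dist_le (by positivity)).2 fun t => ?_
    have h1 := abs_shiftMean_greenKernel_le hd t
    have h2 := hdamp hd t
    rw [← shiftMean_sub continuous_greenKernel v.continuous w.continuous] at h1
    rw [← shiftMean_sub continuous_sawtoothKernel v.continuous w.continuous] at h2
    have h3 := hFL t (shiftMean greenKernel v t) (shiftMean greenKernel w t)
    have h4 : 2 * A * |shiftMean greenKernel v t - shiftMean greenKernel w t| ≤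
        2 / 5 * (3 / 2 * dist v w) :=
      mul_le_mul (by linarith) h1 (abs_nonneg _) (by norm_num)
    have hd0 : 0 ≤ dist v w := dist_nonneg
    have h5 := abs_sub (F t (shiftMean greenKernel v t) - F t (shiftMean greenKernel w t))
      (η * (shiftMean sawtoothKernel v t - shiftMean sawtoothKernel w t))
    change |_ - _| ≤ _
    calc _ = |F t (shiftMean greenKernel v t) - F t (shiftMean greenKernel w t) -
          η * (shiftMean sawtoothKernel v t - shiftMean sawtoothKernel w t)| := by
          congr 1
          simp only [T, BoundedContinuousFunction.coe_ofNormedAddCommGroup]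
          ring
      _ ≤ 4 / 5 * dist v w := by linarith
      _ = _ := by norm_num
  have huniq : ∀ v : ℝ → ℝ, Continuous v → (∃ C, ∀ t, |v t| ≤ C) →
      (∀ t, v t = F t (shiftMean greenKernel v t) - η * shiftMean sawtoothKernel v t) →
      v = ContractingWith.fixedPoint T hT := by
    rintro v hv ⟨C, hC⟩ hfix
    have h := hT.fixedPoint_unique
      (x := BoundedContinuousFunction.ofNormedAddCommGroup v hv C hC)
      (BoundedContinuousFunction.ext fun t => (hfix t).symm)
    rw [← h, BoundedContinuousFunction.coe_ofNormedAddCommGroup]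
  set w := ContractingWith.fixedPoint T hT
  have hTw : T w = w := hT.fixedPoint_isFixedPt
  have hfix : ∀ t, w t = F t (shiftMean greenKernel w t) - η * shiftMean sawtoothKernel w t :=
    fun t => (congrArg (fun g : BoundedContinuousFunction ℝ ℝ => g t) hTw).symm
  have hwn : ∀ t, |w t| ≤ ‖w‖ := fun t => w.norm_coe_le_norm t
  have hwA : ‖w‖ ≤ A + 1 / 25 * ‖w‖ :=
    (BoundedContinuousFunction.norm_le (by positivity)).2 fun t => by
      rw [hfix t]; exact hbound hwn t
  refine ⟨w, w.continuous, fun t => ?_, fun t => ?_, hfix, huniq⟩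
  · refine congrFun (huniq (fun t => w (t + 2 * π)) ?_ ⟨‖w‖, fun t => hwn _⟩ fun t => ?_) t
    · have := w.continuous
      fun_prop
    · rw [shiftMean_comp_add, shiftMean_comp_add, ← hFper t]
      exact hfix _
  · linarith [hwn t]

lemma existsUnique_periodic_solution {F : ℝ → ℝ → ℝ} (hF : Continuous fun z : ℝ × ℝ => F z.1 z.2)
    (hFper : ∀ t y, F (t + 2 * π) y = F t y) {A : ℝ} (hFA : ∀ t y, |F t y| ≤ A)
    (hFL : ∀ t y z, |F t y - F t z| ≤ 2 * A * |y - z|) (hA : 5 * A < 1)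
    {η : ℝ} (hη0 : 0 ≤ η) (hη : η ≤ 1 / 100) :
    ∃! u : ℝ → ℝ, Continuous u ∧ Function.Periodic u (2 * π) ∧
      (∫ t in (0:ℝ)..(2 * π), u t = 0) ∧ (∀ t, |u t| ≤ 5 / 2 * A) ∧
      ContDiff ℝ 2 u ∧
      ∀ t, deriv (deriv u) t + η * deriv u t =
        F t (u t) - (1 / (2 * π)) * ∫ s in (0:ℝ)..(2 * π), F s (u s) := by
  have hpi := pi_ne_zero
  have hA0 : 0 ≤ A := (abs_nonneg _).trans (hFA 0 0)
  obtain ⟨w, hwc, hwper, hwA, hwfix, huniq⟩ :=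
    exists_unique_bounded_fixedPoint hF hFper hFA hFL hA hη0 hη
  set c : ℝ := (1 / (2 * π)) * ∫ s in (0:ℝ)..(2 * π), w s with hc
  have hwcc : Continuous fun t => w t - c := hwc.sub continuous_const
  obtain ⟨v, hv, hvper, hv0⟩ := exists_periodic_primitive_s12 (w := fun t => w t - c) hwcc
    (fun t => by simp only [hwper t]) (by
      rw [intervalIntegral.integral_sub (hwc.intervalIntegrable _ _)
        (continuous_const.intervalIntegrable _ _), intervalIntegral.integral_const, smul_eq_mul, hc]
      field_simp
      ring)
  have hvc : Continuous v := continuous_iff_continuousAt.2 fun t => (hv t).continuousAt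
  obtain ⟨u, hu, huper, hu0⟩ := exists_periodic_primitive_s12 hvc hvper hv0
  have huc : Continuous u := continuous_iff_continuousAt.2 fun t => (hu t).continuousAt
  have hdu : deriv u = v := funext fun t => (hu t).deriv
  have hdv : deriv v = fun t => w t - c := funext fun t => (hv t).deriv
  have huw : ∀ t, shiftMean greenKernel w t = u t := fun t => by
    rw [← shiftMean_sub_const continuous_greenKernel hwc integral_greenKernel c]
    exact shiftMean_greenKernel_deriv_deriv hu hv hwcc huper hu0 t
  have hvw : ∀ t, shiftMean sawtoothKernel w t = v t := fun t => by
    rw [← shiftMean_sub_const continuous_sawtoothKernel hwc integral_sawtoothKernel c]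
    exact shiftMean_sawtoothKernel_deriv hv hwcc hvper hv0 t
  have hFu : Continuous fun t => F t (u t) := hF.comp (continuous_id.prodMk huc)
  have hweq : ∀ t, w t = F t (u t) - η * v t := fun t => by rw [hwfix t, huw, hvw]
  have hcF : c = (1 / (2 * π)) * ∫ s in (0:ℝ)..(2 * π), F s (u s) := by
    rw [hc]
    simp only [hweq]
    rw [intervalIntegral.integral_sub (hFu.intervalIntegrable _ _)
      (Continuous.intervalIntegrable (by fun_prop) _ _), intervalIntegral.integral_const_mul,
      hv0, mul_zero, sub_zero]
  refine ⟨u, ⟨huc, huper, hu0, fun t => ?_, ?_, fun t => ?_⟩, ?_⟩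
  · rw [← huw]
    linarith [abs_shiftMean_greenKernel_le hwA t]
  · rw [show (2 : WithTop ℕ∞) = 1 + 1 by norm_num, contDiff_succ_iff_deriv, hdu,
      contDiff_one_iff_deriv, hdv]
    exact ⟨fun t => (hu t).differentiableAt, by simp, fun t => (hv t).differentiableAt, hwcc⟩
  · rw [hdu, hdv, ← hcF]
    simp only [hweq]
    ring
  · rintro y ⟨hyc, hyper, hy0, -, hy2, hyeq⟩
    rw [show (2 : WithTop ℕ∞) = 1 + 1 by norm_num, contDiff_succ_iff_deriv,
      contDiff_one_iff_deriv] at hy2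
    obtain ⟨hyd, -, hyd', hyc''⟩ := hy2
    have h1 : ∀ t, HasDerivAt y (deriv y t) t := fun t => (hyd t).hasDerivAt
    have h2 : ∀ t, HasDerivAt (deriv y) (deriv (deriv y) t) t := fun t => (hyd' t).hasDerivAt
    have hyc' : Continuous (deriv y) := hyd'.continuous
    have hyper' : Function.Periodic (deriv y) (2 * π) := periodic_of_hasDerivAt_s12 h1 hyper
    set b : ℝ := (1 / (2 * π)) * ∫ s in (0:ℝ)..(2 * π), F s (y s)
    set z : ℝ → ℝ := fun t => F t (y t) - η * deriv y t with hz
    have hzc : Continuous z :=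
      (hF.comp (continuous_id.prodMk hyc)).sub (continuous_const.mul hyc')
    have hzper : Function.Periodic z (2 * π) := fun t => by
      simp only [hz, hyper t, hyper' t, hFper]
    have hy'' : deriv (deriv y) = fun t => z t - b := funext fun t => by
      simp only [hz]
      linarith [hyeq t]
    have hyz : ∀ t, shiftMean greenKernel z t = y t := fun t => by
      rw [← shiftMean_sub_const continuous_greenKernel hzc integral_greenKernel b, ← hy'']
      exact shiftMean_greenKernel_deriv_deriv h1 h2 hyc'' hyper hy0 t
    have hyz' : ∀ t, shiftMean sawtoothKernel z t = deriv y t := fun t => by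
      rw [← shiftMean_sub_const continuous_sawtoothKernel hzc integral_sawtoothKernel b, ← hy'']
      exact shiftMean_sawtoothKernel_deriv h2 hyc'' hyper'
        (integral_deriv_eq_zero_of_periodic h1 hyc' hyper) t
    obtain ⟨C, hC⟩ := (hzper.isBounded_of_continuous (by positivity) hzc).exists_norm_le
    have hzw : z = w := huniq z hzc ⟨C, fun t => hC _ ⟨t, rfl⟩⟩ fun t => by rw [hyz, hyz']
    funext t
    rw [← hyz, ← huw, hzw]

lemma abs_sub_le_of_kepler {e : ℝ} (he : e ∈ Set.Ico (0 : ℝ) 1) {a b s t : ℝ}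
    (ha : s = a - e * sin a) (hb : t = b - e * sin b) : (1 - e) * |a - b| ≤ |s - t| := by
  have h1 : |e * (sin a - sin b)| ≤ e * |a - b| := by
    rw [abs_mul, abs_of_nonneg he.1]
    exact mul_le_mul_of_nonneg_left (abs_sin_sub_sin_le a b) he.1
  have h2 : a - b = (s - t) + e * (sin a - sin b) := by rw [ha, hb]; ring
  have h3 := abs_add_le (s - t) (e * (sin a - sin b))
  rw [← h2] at h3
  linarith

lemma continuous_of_kepler {e : ℝ} (he : e ∈ Set.Ico (0 : ℝ) 1) {uE : ℝ → ℝ}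
    (huE : ∀ t, t = uE t - e * sin (uE t)) : Continuous uE := by
  have h1 : 0 < 1 - e := sub_pos.2 he.2
  refine (LipschitzWith.of_dist_le_mul (K := ⟨(1 - e)⁻¹, by positivity⟩) fun s t => ?_).continuous
  change |uE s - uE t| ≤ (1 - e)⁻¹ * |s - t|
  rw [le_inv_mul_iff₀ h1]
  exact abs_sub_le_of_kepler he (huE s) (huE t)

lemma kepler_add_int_mul_two_pi {e : ℝ} (he : e ∈ Set.Ico (0 : ℝ) 1) {uE : ℝ → ℝ}
    (huE : ∀ t, t = uE t - e * sin (uE t)) (t : ℝ) (n : ℤ) :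
    uE (t + n * (2 * π)) = uE t + n * (2 * π) := by
  have h1 : 0 < 1 - e := sub_pos.2 he.2
  have h := abs_sub_le_of_kepler he (huE (t + n * (2 * π)))
    (b := uE t + n * (2 * π)) (t := t + n * (2 * π)) (by
      rw [sin_add_int_mul_two_pi]
      linarith [huE t])
  rw [sub_self, abs_zero] at h
  have h2 := nonpos_of_mul_nonpos_right h h1
  exact sub_eq_zero.1 (abs_nonpos_iff.1 h2)

lemma abs_sin_div_cube_sub_le {ρ d : ℝ} (hd : 0 < d) (hρ : d ≤ ρ) (a b : ℝ) :
    |sin a / ρ ^ 3 - sin b / ρ ^ 3| ≤ |a - b| / d ^ 3 := by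
  have hρ0 : 0 < ρ := hd.trans_le hρ
  rw [← sub_div, abs_div, abs_of_pos (pow_pos hρ0 3)]
  exact div_le_div₀ (abs_nonneg _) (abs_sin_sub_sin_le a b) (pow_pos hd 3)
    (pow_le_pow_left₀ hd.le hρ 3)

theorem stmt_12 (e : ℝ) (he : e ∈ Set.Ico (0 : ℝ) 1)
    (uE : ℝ → ℝ) (huE : ∀ t, t = uE t - e * Real.sin (uE t))
    (fE : ℝ → ℝ)
    (hfEc : ∀ t, Real.cos (fE t) = (Real.cos (uE t) - e) / (1 - e * Real.cos (uE t)))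
    (hfEs : ∀ t, Real.sin (fE t) =
      Real.sqrt (1 - e ^ 2) * Real.sin (uE t) / (1 - e * Real.cos (uE t)))
    (fx : ℝ → ℝ → ℝ)
    (hfx : ∀ x t, fx x t = Real.sin (2 * x - 2 * fE t) / (1 - e * Real.cos (uE t)) ^ 3)
    (p q : ℤ) (hp : p ≠ 0) (hq : q ≠ 0) (ξ : ℝ)
    (ηh : ℝ) (hηh0 : 0 ≤ ηh) (hηh : ηh ≤ (π / 5) * (10 / π ^ 2 - 1))
    (εh : ℝ) (hεh0 : 0 ≤ εh) (hεh : 5 * εh / (1 - e) ^ 3 < 1)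
    (R : ℝ) (hR : R = (5 / 2) * εh / (1 - e) ^ 3) :
    ∃! u : ℝ → ℝ, Continuous u ∧ Function.Periodic u (2 * π) ∧
      (∫ t in (0:ℝ)..(2 * π), u t = 0) ∧ (∀ t, |u t| ≤ R) ∧
      ContDiff ℝ 2 u ∧
      ∀ t, deriv (deriv u) t + ηh * deriv u t =
        εh * (-(fx (ξ + (p : ℝ) * t + u t) ((q : ℝ) * t)) +
          (1 / (2 * π)) * ∫ s in (0:ℝ)..(2 * π), fx (ξ + (p : ℝ) * s + u s) ((q : ℝ) * s)) := by
  have hpi := pi_pos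
  have hd : 0 < 1 - e := sub_pos.2 he.2
  have hd3 : 0 < (1 - e) ^ 3 := pow_pos hd 3
  have hρ : ∀ t, 1 - e ≤ 1 - e * cos (uE t) := fun t => by
    have := mul_le_mul_of_nonneg_left (cos_le_one (uE t)) he.1
    linarith
  have hρ0 : ∀ t, 1 - e * cos (uE t) ≠ 0 := fun t => (hd.trans_le (hρ t)).ne'
  have hη : ηh ≤ 1 / 100 := by
    refine hηh.trans ?_
    have h : π / 5 * (10 / π ^ 2 - 1) = 2 / π - π / 5 := by field_simp; ring
    have h2 : 2 / π ≤ 2 / 3.14 := div_le_div_of_nonneg_left (by norm_num) (by norm_num) pi_gt_d2.le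
    rw [h]
    norm_num at h2 ⊢
    linarith [pi_gt_d2]
  have huc := continuous_of_kepler he huE
  have hcc : Continuous fun t => cos (fE t) := by
    simp only [hfEc]
    exact Continuous.div (by fun_prop) (by fun_prop) hρ0
  have hsc : Continuous fun t => sin (fE t) := by
    simp only [hfEs]
    exact Continuous.div (by fun_prop) (by fun_prop) hρ0
  have hsin : ∀ x t, sin (2 * x - 2 * fE t) =
      sin (2 * x) * (2 * cos (fE t) ^ 2 - 1) - cos (2 * x) * (2 * sin (fE t) * cos (fE t)) := by
    intro x t
    rw [sin_sub, cos_two_mul, sin_two_mul (fE t)]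
  have hfxc : Continuous fun z : ℝ × ℝ => fx z.1 z.2 := by
    obtain ⟨c, hc, hcE⟩ : ∃ c : ℝ → ℝ, Continuous c ∧ ∀ t, cos (fE t) = c t :=
      ⟨_, hcc, fun _ => rfl⟩
    obtain ⟨s, hs, hsE⟩ : ∃ s : ℝ → ℝ, Continuous s ∧ ∀ t, sin (fE t) = s t :=
      ⟨_, hsc, fun _ => rfl⟩
    simp only [hfx, hsin, hcE, hsE]
    exact Continuous.div (by fun_prop) (by fun_prop) fun z => pow_ne_zero 3 (hρ0 z.2)
  have hfxL : ∀ x y t, |fx x t - fx y t| ≤ 2 * |x - y| / (1 - e) ^ 3 := by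
    intro x y t
    rw [hfx, hfx]
    refine (abs_sin_div_cube_sub_le hd (hρ t) _ _).trans_eq ?_
    rw [show 2 * x - 2 * fE t - (2 * y - 2 * fE t) = 2 * (x - y) by ring, abs_mul, abs_two]
  have hfxb : ∀ x t, |fx x t| ≤ 1 / (1 - e) ^ 3 := by
    intro x t
    rw [hfx, abs_div, abs_of_pos (pow_pos (hd.trans_le (hρ t)) 3)]
    exact div_le_div₀ zero_le_one (abs_sin_le_one _) hd3 (pow_le_pow_left₀ hd.le (hρ t) 3)
  have hfxper : ∀ x t (m n : ℤ), fx (x + m * (2 * π)) (t + n * (2 * π)) = fx x t := by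
    intro x t m n
    have hu := kepler_add_int_mul_two_pi he huE t n
    have h2 : 2 * (x + m * (2 * π)) = 2 * x + ((2 * m : ℤ) : ℝ) * (2 * π) := by push_cast; ring
    rw [hfx, hfx, hsin, hsin, h2]
    simp only [hfEc, hfEs, hu, sin_add_int_mul_two_pi, cos_add_int_mul_two_pi]
  have key := existsUnique_periodic_solution
    (F := fun t y => -(εh * fx (ξ + p * t + y) (q * t))) (A := εh / (1 - e) ^ 3)
    ((continuous_const.mul (hfxc.comp
      (f := fun z : ℝ × ℝ => (ξ + p * z.1 + z.2, q * z.1)) (by fun_prop))).neg)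
    (fun t y => by
      have h := hfxper (ξ + p * t + y) (q * t) p q
      rw [← h]
      ring_nf)
    (fun t y => by
      rw [abs_neg, abs_mul, abs_of_nonneg hεh0, div_eq_mul_one_div]
      exact mul_le_mul_of_nonneg_left (hfxb _ _) hεh0)
    (fun t y z => by
      rw [neg_sub_neg, ← mul_sub, abs_mul, abs_of_nonneg hεh0, abs_sub_comm]
      refine (mul_le_mul_of_nonneg_left (hfxL _ _ _) hεh0).trans_eq ?_
      rw [add_sub_add_left_eq_sub]
      ring)
    (by rwa [← mul_div_assoc]) hηh0 hη
  have hrhs : ∀ (u : ℝ → ℝ) (t : ℝ),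
      -(εh * fx (ξ + p * t + u t) (q * t)) - 1 / (2 * π) *
        ∫ s in (0:ℝ)..(2 * π), -(εh * fx (ξ + p * s + u s) (q * s)) =
      εh * (-(fx (ξ + (p : ℝ) * t + u t) ((q : ℝ) * t)) +
        (1 / (2 * π)) * ∫ s in (0:ℝ)..(2 * π), fx (ξ + (p : ℝ) * s + u s) ((q : ℝ) * s)) := by
    intro u t
    rw [intervalIntegral.integral_neg, intervalIntegral.integral_const_mul]
    ring
  simpa only [hrhs, ← mul_div_assoc, ← hR] using key
end

section
/- Let e ∈ [0,1). Then for every ξ ∈ ℝ, (1/2π)·∫₀^{2π} f_x(ξ + t, t) dt = −2·α_2(e)·sin(2ξ), where the left-hand side (a real number) is regarded as a complex number. -/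
open Real

/-- The Kepler map expands distances by a factor of at least one minus the eccentricity. -/
lemma kepler_sub_le {e : ℝ} (he : e ∈ Set.Ico (0 : ℝ) 1) (u v : ℝ) :
    (1 - e) * |u - v| ≤ |(u - e * Real.sin u) - (v - e * Real.sin v)| := by
  have hs := Real.abs_sin_sub_sin_le u v
  have h3 : |u - v| - |e * (Real.sin u - Real.sin v)| ≤
      |(u - v) - e * (Real.sin u - Real.sin v)| := abs_sub_abs_le_abs_sub _ _
  rw [abs_mul, abs_of_nonneg he.1] at h3
  have h4 : (u - e * Real.sin u) - (v - e * Real.sin v) =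
      (u - v) - e * (Real.sin u - Real.sin v) := by ring
  rw [h4]
  nlinarith [mul_le_mul_of_nonneg_left hs he.1]

lemma kepler_injective {e : ℝ} (he : e ∈ Set.Ico (0 : ℝ) 1) :
    Function.Injective fun u : ℝ => u - e * Real.sin u := by
  intro u v huv
  have h := kepler_sub_le he u v
  simp only at huv
  rw [huv, sub_self, abs_zero] at h
  have h1 : 0 < 1 - e := sub_pos.2 he.2
  have h2 : |u - v| ≤ 0 := by
    by_contra! hc
    nlinarith [mul_pos h1 hc]
  exact sub_eq_zero.1 (abs_nonpos_iff.1 h2)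

lemma kepler_continuous {e : ℝ} (he : e ∈ Set.Ico (0 : ℝ) 1) {uE : ℝ → ℝ}
    (huE : ∀ t, t = uE t - e * Real.sin (uE t)) : Continuous uE := by
  have h1 : 0 < 1 - e := sub_pos.2 he.2
  refine (LipschitzWith.of_dist_le_mul (K := (1 - e)⁻¹.toNNReal) fun s t => ?_).continuous
  rw [Real.coe_toNNReal _ (inv_nonneg.2 h1.le), Real.dist_eq, Real.dist_eq, inv_mul_eq_div,
    le_div_iff₀ h1, mul_comm]
  have h := kepler_sub_le he (uE s) (uE t)
  rwa [← huE s, ← huE t] at h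

lemma kepler_two_pi_sub {e : ℝ} (he : e ∈ Set.Ico (0 : ℝ) 1) {uE : ℝ → ℝ}
    (huE : ∀ t, t = uE t - e * Real.sin (uE t)) (t : ℝ) :
    uE (2 * π - t) = 2 * π - uE t := by
  apply kepler_injective he
  simp only [Real.sin_two_pi_sub]
  linarith [huE t, huE (2 * π - t)]

lemma kepler_radius_pos {e : ℝ} (he : e ∈ Set.Ico (0 : ℝ) 1) (u : ℝ) :
    0 < 1 - e * Real.cos u := by
  nlinarith [he.1, he.2, Real.cos_le_one u]

theorem stmt_14 (e : ℝ) (he : e ∈ Set.Ico (0 : ℝ) 1)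
    (uE : ℝ → ℝ) (huE : ∀ t, t = uE t - e * Real.sin (uE t))
    (fE : ℝ → ℝ)
    (hfEc : ∀ t, Real.cos (fE t) = (Real.cos (uE t) - e) / (1 - e * Real.cos (uE t)))
    (hfEs : ∀ t, Real.sin (fE t) =
      Real.sqrt (1 - e ^ 2) * Real.sin (uE t) / (1 - e * Real.cos (uE t)))
    (fx : ℝ → ℝ → ℝ)
    (hfx : ∀ x t, fx x t = Real.sin (2 * x - 2 * fE t) / (1 - e * Real.cos (uE t)) ^ 3)
    (G : ℝ → ℂ)
    (hG : ∀ t, G t = -Complex.exp (2 * Complex.I * (fE t)) /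
      (2 * ((1 - e * Real.cos (uE t) : ℝ) : ℂ) ^ 3))
    (α₂ : ℂ)
    (hα₂ : α₂ = (1 / (2 * π) : ℂ) *
      ∫ t in (0:ℝ)..(2 * π), G t * Complex.exp (-(2 : ℂ) * Complex.I * t)) :
    ∀ ξ : ℝ, (((1 / (2 * π)) * ∫ t in (0:ℝ)..(2 * π), fx (ξ + t) t : ℝ) : ℂ) =
      -2 * α₂ * (Real.sin (2 * ξ) : ℂ) := by
  intro ξ
  have hu := kepler_continuous he huE
  have hρ : ∀ t, 1 - e * Real.cos (uE t) ≠ 0 := fun t => (kepler_radius_pos he _).ne'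
  have hcf : Continuous fun t => Real.cos (fE t) := by
    simp only [hfEc]
    exact Continuous.div (by fun_prop) (by fun_prop) hρ
  have hsf : Continuous fun t => Real.sin (fE t) := by
    simp only [hfEs]
    exact Continuous.div (by fun_prop) (by fun_prop) hρ
  set A : ℝ → ℝ := fun t => Real.cos (2 * fE t - 2 * t) / (1 - e * Real.cos (uE t)) ^ 3 with hA
  set B : ℝ → ℝ := fun t => Real.sin (2 * fE t - 2 * t) / (1 - e * Real.cos (uE t)) ^ 3 with hB
  have hAc : Continuous A := by
    simp only [hA, Real.cos_sub, Real.cos_two_mul (fE _), Real.sin_two_mul (fE _)]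
    exact Continuous.div (by fun_prop) (by fun_prop) fun t => pow_ne_zero 3 (hρ t)
  have hBc : Continuous B := by
    simp only [hB, Real.sin_sub, Real.cos_two_mul (fE _), Real.sin_two_mul (fE _)]
    exact Continuous.div (by fun_prop) (by fun_prop) fun t => pow_ne_zero 3 (hρ t)
  have hBodd : ∀ t, B (2 * π - t) = -B t := by
    intro t
    have h1 : Real.cos (fE (2 * π - t)) = Real.cos (fE t) := by
      rw [hfEc, hfEc, kepler_two_pi_sub he huE, Real.cos_two_pi_sub]
    have h2 : Real.sin (fE (2 * π - t)) = -Real.sin (fE t) := by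
      rw [hfEs, hfEs, kepler_two_pi_sub he huE, Real.cos_two_pi_sub, Real.sin_two_pi_sub]
      ring
    have h3 : Real.cos (2 * (2 * π - t)) = Real.cos (2 * t) := by
      rw [Real.cos_two_mul, Real.cos_two_mul, Real.cos_two_pi_sub]
    have h4 : Real.sin (2 * (2 * π - t)) = -Real.sin (2 * t) := by
      rw [Real.sin_two_mul, Real.sin_two_mul, Real.cos_two_pi_sub, Real.sin_two_pi_sub]
      ring
    simp only [hB, Real.sin_sub, Real.cos_two_mul (fE _), Real.sin_two_mul (fE _), h1, h2, h3, h4,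
      kepler_two_pi_sub he huE, Real.cos_two_pi_sub]
    ring
  have hB0 : ∫ t in (0:ℝ)..(2 * π), B t = 0 := by
    have h := intervalIntegral.integral_comp_sub_left (a := 0) (b := 2 * π) B (2 * π)
    simp only [hBodd, intervalIntegral.integral_neg, sub_self, sub_zero] at h
    linarith
  have hL : ∫ t in (0:ℝ)..(2 * π), fx (ξ + t) t =
      Real.sin (2 * ξ) * ∫ t in (0:ℝ)..(2 * π), A t := by
    have h : ∀ t, fx (ξ + t) t = Real.sin (2 * ξ) * A t - Real.cos (2 * ξ) * B t := by
      intro t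
      have : 2 * (ξ + t) - 2 * fE t = 2 * ξ - (2 * fE t - 2 * t) := by ring
      rw [hfx, this, Real.sin_sub]
      simp only [hA, hB]
      ring
    simp only [h]
    rw [intervalIntegral.integral_sub ((hAc.const_mul _).intervalIntegrable _ _)
      ((hBc.const_mul _).intervalIntegrable _ _), intervalIntegral.integral_const_mul,
      intervalIntegral.integral_const_mul, hB0, mul_zero, sub_zero]
  have hR : ∫ t in (0:ℝ)..(2 * π), G t * Complex.exp (-(2 : ℂ) * Complex.I * t) =
      -(1 / 2) * ((∫ t in (0:ℝ)..(2 * π), A t : ℝ) : ℂ) := by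
    have h : ∀ t : ℝ, G t * Complex.exp (-(2 : ℂ) * Complex.I * t) =
        -(1 / 2) * (A t : ℂ) + -(Complex.I / 2) * (B t : ℂ) := by
      intro t
      have h1 : Complex.exp (2 * Complex.I * (fE t)) * Complex.exp (-(2 : ℂ) * Complex.I * t) =
          (Real.cos (2 * fE t - 2 * t) : ℂ) + (Real.sin (2 * fE t - 2 * t) : ℂ) * Complex.I := by
        rw [← Complex.exp_add, Complex.ofReal_cos, Complex.ofReal_sin, ← Complex.exp_mul_I]
        congr 1
        push_cast
        ring
      have h2 : ((1 - e * Real.cos (uE t) : ℝ) : ℂ) ≠ 0 := Complex.ofReal_ne_zero.2 (hρ t)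
      rw [hG, div_mul_eq_mul_div, neg_mul, h1]
      simp only [hA, hB, Complex.ofReal_div, Complex.ofReal_pow]
      field_simp
      ring
    simp only [h]
    rw [intervalIntegral.integral_add
      (Continuous.intervalIntegrable (by fun_prop) _ _)
      (Continuous.intervalIntegrable (by fun_prop) _ _), intervalIntegral.integral_const_mul,
      intervalIntegral.integral_const_mul, intervalIntegral.integral_ofReal,
      intervalIntegral.integral_ofReal, hB0, Complex.ofReal_zero, mul_zero, add_zero]
  rw [hL, hα₂, hR]
  push_cast
  ring
end
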